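/- arXiv:2010.10987 — 3 statements merged into one kernel-verified Lean document; each statement's English description precedes it below -/
import Mathlib

section
/- If ℓ : ℝᵈ → ℝ is measurable and bounded with 0 ≤ ℓ(t) ≤ M for all t, then the Gaussian-smoothed function ℓ̂(x) = E_{z∼N(0,σ²I)}[ℓ(x+z)] has its Hessian bounded in operator norm by 2M/σ², i.e., ‖∇²ℓ̂(x)‖₂ ≤ 2M/σ² for all x. -/
open MeasureTheory Real

set_option synthInstance.maxHeartbeats 400000
set_option maxHeartbeats 1000000

namespace GSH

lemma ns {G : Type*} [NormedAddCommGroup G] [NormedSpace ℝ G] (c : ℝ) (y : G) :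
    ‖c • y‖ = ‖c‖ * ‖y‖ := norm_smul c y

lemma cadd {X G : Type*} [TopologicalSpace X] [NormedAddCommGroup G] {f h : X → G}
    (hf : Continuous f) (hh : Continuous h) : Continuous (fun x => f x + h x) := hf.add hh

lemma nadd {G : Type*} [NormedAddCommGroup G] (x y : G) : ‖x + y‖ ≤ ‖x‖ + ‖y‖ := norm_add_le x y

abbrev EE (d : ℕ) := EuclideanSpace ℝ (Fin d)

noncomputable def J (d : ℕ) : EE d →L[ℝ] EE d →L[ℝ] ℝ := innerSL ℝ

lemma J_apply {d : ℕ} (u v : EE d) : J d u v = inner ℝ u v := rfl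

lemma norm_J_apply {d : ℕ} (u : EE d) : ‖J d u‖ = ‖u‖ := innerSL_apply_norm (𝕜 := ℝ) u

lemma norm_J_le {d : ℕ} : ‖J d‖ ≤ 1 :=
  ContinuousLinearMap.opNorm_le_bound _ zero_le_one (fun u => by rw [norm_J_apply, one_mul])

noncomputable def g {d : ℕ} (b : ℝ) (z : EE d) : ℝ := exp (-b * ‖z‖ ^ 2)

noncomputable def g1 {d : ℕ} (b : ℝ) (z : EE d) : EE d →L[ℝ] ℝ := (-2 * b * g b z) • J d z

noncomputable def g2 {d : ℕ} (b : ℝ) (z : EE d) : EE d →L[ℝ] EE d →L[ℝ] ℝ :=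
  (-2 * b * g b z) • J d + ((-2 * b) • g1 b z).smulRight (J d z)

lemma g_pos {d : ℕ} (b : ℝ) (z : EE d) : 0 < g b z := exp_pos _

lemma hasFDerivAt_g {d : ℕ} (b : ℝ) (z : EE d) : HasFDerivAt (g b) (g1 b z) z := by
  have h := (((hasStrictFDerivAt_norm_sq z).hasFDerivAt).const_mul (-b)).exp
  convert! h using 1
  ext u
  simp [g1, g, J_apply]
  ring

lemma hasFDerivAt_g1 {d : ℕ} (b : ℝ) (z : EE d) : HasFDerivAt (g1 b) (g2 b z) z :=
  ((hasFDerivAt_g b z).const_mul (-2 * b)).smul (J d).hasFDerivAt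

lemma cont_g {d : ℕ} (b : ℝ) : Continuous (g b : EE d → ℝ) := by
  unfold g; fun_prop

lemma cont_g1 {d : ℕ} (b : ℝ) : Continuous (g1 b : EE d → _) :=
  continuous_iff_continuousAt.2 fun z => (hasFDerivAt_g1 b z).continuousAt

lemma cont_g2 {d : ℕ} (b : ℝ) : Continuous (g2 b : EE d → _) := by
  have h1 := cont_g (d := d) b
  have h2 := cont_g1 (d := d) b
  have h3 := (J d).continuous
  unfold g2
  have c1 : Continuous (fun z : EE d => (-2 * b * g b z) • J d) :=
    (continuous_const.mul h1).smul continuous_const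
  have c2 : Continuous (fun z : EE d => ((-2 * b) • g1 b z).smulRight (J d z)) :=
    (ContinuousLinearMap.smulRightL ℝ (EE d) (EE d →L[ℝ] ℝ)).continuous₂.comp
      ((h2.const_smul (-2 * b)).prodMk h3)
  exact cadd (G := EE d →L[ℝ] EE d →L[ℝ] ℝ) c1 c2

lemma integrable_g {d : ℕ} {b : ℝ} (hb : 0 < b) : Integrable (g b : EE d → ℝ) := by
  have h := (GaussianFourier.integrable_cexp_neg_mul_sq_norm_add (V := EE d)
    (b := (b : ℂ)) (by simpa using hb) 0 0).norm
  refine h.congr (Filter.Eventually.of_forall fun z => ?_)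
  simp [g, Complex.norm_exp, ← Complex.ofReal_pow]

lemma poly_le {d : ℕ} {b : ℝ} (hb : 0 < b) (z : EE d) :
    (1 + ‖z‖ ^ 2) * g b z ≤ (1 + 2 / b) * g (b / 2) z := by
  have h1 : g b z = g (b / 2) z * g (b / 2) z := by
    unfold g; rw [← exp_add]; congr 1; ring
  have h2 : g (b / 2) z * exp (b / 2 * ‖z‖ ^ 2) = 1 := by
    unfold g; rw [← exp_add]; simp
  have h3 := add_one_le_exp (b / 2 * ‖z‖ ^ 2)
  have h4 := g_pos (b / 2) z
  have h5 : (1 + ‖z‖ ^ 2) ≤ (1 + 2 / b) * exp (b / 2 * ‖z‖ ^ 2) := by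
    have : (1 + 2 / b) * (b / 2 * ‖z‖ ^ 2 + 1) ≤ (1 + 2 / b) * exp (b / 2 * ‖z‖ ^ 2) := by gcongr
    refine le_trans ?_ this
    have e : (1 + 2 / b) * (b / 2 * ‖z‖ ^ 2 + 1) = 1 + ‖z‖ ^ 2 + (2 / b + b / 2 * ‖z‖ ^ 2) := by
      field_simp; ring
    rw [e]
    have : 0 ≤ 2 / b + b / 2 * ‖z‖ ^ 2 := by positivity
    linarith
  calc (1 + ‖z‖ ^ 2) * g b z ≤ ((1 + 2 / b) * exp (b / 2 * ‖z‖ ^ 2)) * g b z := by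
        have := g_pos b z; gcongr
    _ = (1 + 2 / b) * g (b / 2) z * (g (b / 2) z * exp (b / 2 * ‖z‖ ^ 2)) := by rw [h1]; ring
    _ = _ := by rw [h2]; ring

lemma bound_g {d : ℕ} {b : ℝ} (hb : 0 < b) (z : EE d) :
    ‖g b z‖ ≤ (1 + 2 / b) * g (b / 2) z := by
  refine le_trans ?_ (poly_le hb z)
  have := g_pos b z
  rw [Real.norm_of_nonneg this.le]
  nlinarith [mul_nonneg (sq_nonneg ‖z‖) this.le]

lemma norm_g1 {d : ℕ} {b : ℝ} (hb : 0 < b) (z : EE d) : ‖g1 b z‖ = 2 * b * g b z * ‖z‖ := by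
  have := g_pos b z
  rw [g1, norm_smul, norm_J_apply]
  simp [abs_of_pos hb, abs_of_pos this]

lemma bound_g1 {d : ℕ} {b : ℝ} (hb : 0 < b) (z : EE d) :
    ‖g1 b z‖ ≤ (2 * b * (1 + 2 / b)) * g (b / 2) z := by
  have := g_pos b z
  have h := poly_le hb z
  rw [norm_g1 hb]
  have h2 : ‖z‖ ≤ 1 + ‖z‖ ^ 2 := by nlinarith [sq_nonneg (‖z‖ - 1), norm_nonneg z]
  calc 2 * b * g b z * ‖z‖ ≤ 2 * b * g b z * (1 + ‖z‖ ^ 2) := by gcongr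
    _ = 2 * b * ((1 + ‖z‖ ^ 2) * g b z) := by ring
    _ ≤ 2 * b * ((1 + 2 / b) * g (b / 2) z) := by gcongr
    _ = _ := by ring

lemma bound_g2 {d : ℕ} {b : ℝ} (hb : 0 < b) (z : EE d) :
    ‖g2 b z‖ ≤ ((2 * b + 4 * b ^ 2) * (1 + 2 / b)) * g (b / 2) z := by
  have := g_pos b z
  have h := poly_le hb z
  have h1 : ‖g2 b z‖ ≤ 2 * b * g b z * 1 + (2 * b * (2 * b * g b z * ‖z‖)) * ‖z‖ := by
    refine (nadd (G := EE d →L[ℝ] EE d →L[ℝ] ℝ) _ _).trans (add_le_add ?_ ?_)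
    · refine (ns (G := EE d →L[ℝ] EE d →L[ℝ] ℝ) _ _).le.trans ?_
      have e : ‖-2 * b * g b z‖ = 2 * b * g b z := by simp [abs_of_pos hb, abs_of_pos this]
      rw [e]
      have := norm_J_le (d := d)
      gcongr
    · rw [ContinuousLinearMap.norm_smulRight_apply, norm_smul, norm_g1 hb, norm_J_apply]
      simp [abs_of_pos hb]
  refine h1.trans ?_
  calc 2 * b * g b z * 1 + (2 * b * (2 * b * g b z * ‖z‖)) * ‖z‖
      = 2 * b * g b z + 4 * b ^ 2 * (‖z‖ ^ 2 * g b z) := by ring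
    _ ≤ (2 * b + 4 * b ^ 2) * ((1 + ‖z‖ ^ 2) * g b z) := by
        have : 0 ≤ 2 * b * (‖z‖ ^ 2 * g b z) + 4 * b ^ 2 * g b z := by positivity
        nlinarith
    _ ≤ (2 * b + 4 * b ^ 2) * ((1 + 2 / b) * g (b / 2) z) := by gcongr
    _ = _ := by ring

lemma g_shift {d : ℕ} {b : ℝ} (hb : 0 < b) (x y t : EE d) (h : x ∈ Metric.ball y 1) :
    g b (x - t) ≤ exp b * g (b / 2) (y - t) := by
  unfold g
  rw [← exp_add]
  apply exp_le_exp.2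
  have h1 : ‖y - t‖ ≤ ‖x - t‖ + 1 := by
    have e : y - t = (x - t) + (y - x) := by abel
    have h2 : ‖y - x‖ < 1 := by rw [← dist_eq_norm, dist_comm]; exact h
    rw [e]; linarith [norm_add_le (x - t) (y - x)]
  have h2 : ‖y - t‖ ^ 2 ≤ 2 * ‖x - t‖ ^ 2 + 2 := by
    nlinarith [norm_nonneg (y - t), norm_nonneg (x - t), sq_nonneg (‖x - t‖ - 1)]
  nlinarith

section
variable {d : ℕ} {G : Type*} [NormedAddCommGroup G] [NormedSpace ℝ G]

lemma integrable_conv {b K M : ℝ} (hb : 0 < b) (ℓ : EE d → ℝ) (hmeas : Measurable ℓ)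
    (hl : ∀ t, ‖ℓ t‖ ≤ M) (φ : EE d → G) (hφ : Continuous φ)
    (hK : ∀ z, ‖φ z‖ ≤ K * g b z) (x : EE d) : Integrable (fun t => ℓ t • φ (x - t)) := by
  have hi : Integrable (fun t => M * (K * g b (x - t))) :=
    (((integrable_g (d := d) hb).comp_sub_left x).const_mul K).const_mul M
  refine hi.mono' ?_ (Filter.Eventually.of_forall fun t => ?_)
  · exact hmeas.aestronglyMeasurable.smul
      (hφ.comp (continuous_const.sub continuous_id)).aestronglyMeasurable
  · rw [norm_smul]
    exact mul_le_mul (hl t) (hK _) (norm_nonneg _) ((norm_nonneg _).trans (hl t))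

lemma hasFDerivAt_conv {b K K' M : ℝ} (hb : 0 < b) (ℓ : EE d → ℝ) (hmeas : Measurable ℓ)
    (hl : ∀ t, ‖ℓ t‖ ≤ M) (φ : EE d → G) (φ' : EE d → EE d →L[ℝ] G) (hφ : Continuous φ)
    (hφ' : Continuous φ') (hd : ∀ z, HasFDerivAt φ (φ' z) z)
    (hK : ∀ z, ‖φ z‖ ≤ K * g b z) (hK' : ∀ z, ‖φ' z‖ ≤ K' * g b z) (x : EE d) :
    HasFDerivAt (fun x => ∫ t, ℓ t • φ (x - t)) (∫ t, ℓ t • φ' (x - t)) x := by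
  have hK0 : 0 ≤ K' := by
    have := (norm_nonneg _).trans (hK' 0)
    exact nonneg_of_mul_nonneg_left this (g_pos b 0)
  have hM0 : 0 ≤ M := (norm_nonneg _).trans (hl 0)
  refine hasFDerivAt_integral_of_dominated_of_fderiv_le (s := Metric.ball x 1)
    (bound := fun t => M * (K' * (exp b * g (b / 2) (x - t))))
    (F' := fun x t => ℓ t • φ' (x - t))
    (Metric.ball_mem_nhds x one_pos)
    (Filter.Eventually.of_forall fun y =>
      (integrable_conv hb ℓ hmeas hl φ hφ hK y).aestronglyMeasurable)
    (integrable_conv hb ℓ hmeas hl φ hφ hK x)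
    (integrable_conv hb ℓ hmeas hl φ' hφ' hK' x).aestronglyMeasurable
    (Filter.Eventually.of_forall fun t y hy => ?_) ?_
    (Filter.Eventually.of_forall fun t y hy => ?_)
  · rw [norm_smul]
    refine mul_le_mul (hl t) ((hK' _).trans ?_) (norm_nonneg _) hM0
    exact mul_le_mul_of_nonneg_left (g_shift hb y x t hy) hK0
  · exact ((((integrable_g (d := d) (half_pos hb)).comp_sub_left x).const_mul _).const_mul K').const_mul M
  · have h1 : HasFDerivAt (fun y : EE d => φ (y - t)) (φ' (y - t)) y :=
      (hasFDerivAt_comp_sub t).2 (hd (y - t))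
    exact h1.const_smul (ℓ t)
end

lemma integrable_sq {d : ℕ} {b : ℝ} (hb : 0 < b) (u v : EE d) :
    Integrable (fun z : EE d => (inner ℝ z u * inner ℝ z v) * g b z) := by
  have hi : Integrable (fun z : EE d => ‖u‖ * ‖v‖ * ((1 + 2 / b) * g (b / 2) z)) :=
    ((integrable_g (half_pos hb)).const_mul _).const_mul _
  refine hi.mono' ?_ (Filter.Eventually.of_forall fun z => ?_)
  · have := cont_g (d := d) b
    exact Continuous.aestronglyMeasurable (by fun_prop)
  · have h0 := g_pos b z
    have h1 : |inner ℝ z u| ≤ ‖z‖ * ‖u‖ := abs_real_inner_le_norm z u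
    have h2 : |inner ℝ z v| ≤ ‖z‖ * ‖v‖ := abs_real_inner_le_norm z v
    rw [norm_mul, norm_mul, Real.norm_of_nonneg h0.le, Real.norm_eq_abs, Real.norm_eq_abs]
    calc |inner ℝ z u| * |inner ℝ z v| * g b z ≤ (‖z‖ * ‖u‖) * (‖z‖ * ‖v‖) * g b z := by gcongr
      _ = ‖u‖ * ‖v‖ * (‖z‖ ^ 2 * g b z) := by ring
      _ ≤ ‖u‖ * ‖v‖ * ((1 + ‖z‖ ^ 2) * g b z) := by gcongr; linarith
      _ ≤ _ := by gcongr ?_ * ?_; exact poly_le hb z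

lemma integrable_lin {d : ℕ} {b : ℝ} (hb : 0 < b) (u : EE d) :
    Integrable (fun z : EE d => inner ℝ z u * g b z) := by
  have hi := ((integrable_sq hb u u).add (integrable_g (d := d) hb))
  refine hi.mono' ?_ (Filter.Eventually.of_forall fun z => ?_)
  · have := cont_g (d := d) b
    exact Continuous.aestronglyMeasurable (by fun_prop)
  · have h0 := g_pos b z
    rw [norm_mul, Real.norm_of_nonneg h0.le, Real.norm_eq_abs]
    have : |inner ℝ z u| ≤ inner ℝ z u * inner ℝ z u + 1 := by
      rw [← abs_mul_abs_self]; nlinarith [sq_nonneg (|inner ℝ z u| - 1), abs_nonneg (inner ℝ z u)]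
    simp only [Pi.add_apply]
    nlinarith

lemma integral_sq {d : ℕ} {b : ℝ} (hb : 0 < b) (u : EE d) :
    2 * b * ∫ z : EE d, (inner ℝ z u * inner ℝ z u) * g b z = ‖u‖ ^ 2 * ∫ z : EE d, g b z := by
  have h := integral_bilinear_hasFDerivAt_right_eq_neg_left_of_integrable (μ := (volume : Measure (EE d)))
    (B := ContinuousLinearMap.mul ℝ ℝ) (f := fun z : EE d => J d u z) (f' := fun _ => J d u)
    (g := g b) (g' := g1 b) (v := u) ?_ ?_ ?_ (fun z _ => (J d u).hasFDerivAt)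
    (fun z _ => hasFDerivAt_g b z)
  · simp only [ContinuousLinearMap.mul_apply', J_apply, real_inner_self_eq_norm_sq,
      integral_const_mul] at h
    rw [← integral_const_mul]
    rw [← neg_inj, ← h, ← integral_neg]
    congr 1; ext z
    simp only [g1, J_apply, smul_apply, smul_eq_mul, real_inner_comm u z]
    ring
  · simpa using (integrable_g (d := d) hb).const_mul (J d u u)
  · refine ((integrable_sq hb u u).const_mul (-2 * b)).congr (Filter.Eventually.of_forall fun z => ?_)
    simp only [ContinuousLinearMap.mul_apply', g1, J_apply, smul_apply,
      smul_eq_mul, real_inner_comm u z]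
    ring
  · refine (integrable_lin hb u).congr (Filter.Eventually.of_forall fun z => ?_)
    simp only [ContinuousLinearMap.mul_apply', J_apply, real_inner_comm u z]

lemma g2_apply {d : ℕ} (b : ℝ) (z u v : EE d) :
    g2 b z u v = -2 * b * g b z * inner ℝ u v + 4 * b ^ 2 * (inner ℝ z u * inner ℝ z v * g b z) := by
  simp [g2, g1, J_apply]
  ring

lemma abs_g2_le {d : ℕ} {b : ℝ} (hb : 0 < b) (z u v : EE d) (hu : ‖u‖ = 1) (hv : ‖v‖ = 1) :
    |g2 b z u v| ≤ 2 * b * g b z +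
      2 * b ^ 2 * (inner ℝ z u * inner ℝ z u * g b z + inner ℝ z v * inner ℝ z v * g b z) := by
  have h0 := g_pos b z
  have h1 : |inner ℝ u v| ≤ 1 := by simpa [hu, hv] using abs_real_inner_le_norm u v
  rw [g2_apply]
  obtain ⟨h2, h3⟩ := abs_le.1 h1
  have hbg : 0 < b * g b z := by positivity
  have hbbg : 0 < b ^ 2 * g b z := by positivity
  generalize (inner ℝ u v : ℝ) = c at *
  generalize (inner ℝ z u : ℝ) = p at *
  generalize (inner ℝ z v : ℝ) = q at *
  rw [abs_le]
  constructor
  · nlinarith [mul_nonneg hbbg.le (sq_nonneg (p + q))]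
  · nlinarith [mul_nonneg hbbg.le (sq_nonneg (p - q))]

lemma integral_bound {d : ℕ} {b M : ℝ} (hb : 0 < b) (ℓ : EE d → ℝ) (hmeas : Measurable ℓ)
    (hl : ∀ t, ‖ℓ t‖ ≤ M) (x : EE d) :
    ‖∫ t, ℓ t • g2 b (x - t)‖ ≤ 4 * b * M * ∫ z : EE d, g b z := by
  have hM0 : 0 ≤ M := (norm_nonneg _).trans (hl 0)
  have hI0 : 0 ≤ ∫ z : EE d, g b z := integral_nonneg fun z => (g_pos b z).le
  have hint := integrable_conv (half_pos hb) ℓ hmeas hl (g2 b) (cont_g2 b) (bound_g2 hb) x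
  refine ContinuousLinearMap.opNorm_le_of_unit_norm (by positivity) fun u hu => ?_
  refine ContinuousLinearMap.opNorm_le_of_unit_norm (by positivity) fun v hv => ?_
  rw [ContinuousLinearMap.integral_apply hint, ContinuousLinearMap.integral_apply
    (hint.apply_continuousLinearMap u)]
  set B : EE d → ℝ := fun z => 2 * b * g b z +
      2 * b ^ 2 * (inner ℝ z u * inner ℝ z u * g b z + inner ℝ z v * inner ℝ z v * g b z) with hB
  have i1 := (integrable_g (d := d) hb).const_mul (2 * b)
  have i2 := integrable_sq hb u u
  have i3 := integrable_sq hb v v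
  have i4 := (i2.add i3).const_mul (2 * b ^ 2)
  have hBi : Integrable B := i1.add i4
  have hBint : ∫ z, B z = 4 * b * ∫ z : EE d, g b z := by
    have e1 := integral_sq hb u
    have e2 := integral_sq hb v
    have : ∫ z, B z = 2 * b * (∫ z : EE d, g b z) + 2 * b ^ 2 *
        ((∫ z : EE d, inner ℝ z u * inner ℝ z u * g b z) +
          ∫ z : EE d, inner ℝ z v * inner ℝ z v * g b z) := by
      rw [← integral_add i2 i3, ← integral_const_mul, ← integral_const_mul]
      exact integral_add i1 i4
    rw [this]
    rw [hu] at e1; rw [hv] at e2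
    linear_combination b * e1 + b * e2
  calc _ ≤ ∫ t, M * B (x - t) := by
        refine norm_integral_le_of_norm_le ((hBi.comp_sub_left x).const_mul M)
          (Filter.Eventually.of_forall fun t => ?_)
        simp only [smul_apply, norm_smul]
        exact mul_le_mul (hl t) (abs_g2_le hb _ u v hu hv) (norm_nonneg _) hM0
    _ = M * ∫ z, B z := by rw [integral_const_mul, integral_sub_left_eq_self B volume x]
    _ = _ := by rw [hBint]; ring

end GSH



/-- the Gaussian smoothing of a measurable loss bounded in `[0, M]`
has second derivative (Hessian) bounded in operator norm by `2M/σ²`. -/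
theorem gaussian_smoothing_hessian_bound
    {d : ℕ} (σ M : ℝ) (hσ : 0 < σ)
    (ℓ : EuclideanSpace ℝ (Fin d) → ℝ) (hmeas : Measurable ℓ)
    (hbound : ∀ t, 0 ≤ ℓ t ∧ ℓ t ≤ M)
    (lhat : EuclideanSpace ℝ (Fin d) → ℝ)
    (hlhat : ∀ x, lhat x =
      (2 * π * σ ^ 2) ^ (-(d : ℝ) / 2) *
        ∫ t, ℓ t * Real.exp (-‖x - t‖ ^ 2 / (2 * σ ^ 2))) :
    ∀ x, ‖iteratedFDeriv ℝ 2 lhat x‖ ≤ 2 * M / σ ^ 2 := by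
  intro x
  set b : ℝ := 1 / (2 * σ ^ 2) with hbdef
  have hb : 0 < b := by positivity
  set C : ℝ := (2 * π * σ ^ 2) ^ (-(d : ℝ) / 2) with hC
  have hC0 : 0 ≤ C := by positivity
  have hl : ∀ t, ‖ℓ t‖ ≤ M := fun t => by
    rw [Real.norm_of_nonneg (hbound t).1]; exact (hbound t).2
  have hfun : lhat = fun x => C * ∫ t, ℓ t • GSH.g b (x - t) := by
    ext y
    rw [hlhat y]
    congr 2
    ext t
    rw [smul_eq_mul, GSH.g]
    congr 2
    rw [hbdef]
    ring
  have hb2 := half_pos hb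
  have hd1 : ∀ y, HasFDerivAt lhat (C • ∫ t, ℓ t • GSH.g1 b (y - t)) y := fun y => by
    rw [hfun]
    exact (GSH.hasFDerivAt_conv hb2 ℓ hmeas hl (GSH.g b) (GSH.g1 b) (GSH.cont_g b) (GSH.cont_g1 b)
      (GSH.hasFDerivAt_g b) (GSH.bound_g hb) (GSH.bound_g1 hb) y).const_mul C
  have hfd : fderiv ℝ lhat = fun y => C • ∫ t, ℓ t • GSH.g1 b (y - t) :=
    funext fun y => (hd1 y).fderiv
  have hd2 : HasFDerivAt (fderiv ℝ lhat) (C • ∫ t, ℓ t • GSH.g2 b (x - t)) x := by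
    rw [hfd]
    exact (GSH.hasFDerivAt_conv hb2 ℓ hmeas hl (GSH.g1 b) (GSH.g2 b) (GSH.cont_g1 b) (GSH.cont_g2 b)
      (GSH.hasFDerivAt_g1 b) (GSH.bound_g1 hb) (GSH.bound_g2 hb) x).const_smul C
  have hn : ‖iteratedFDeriv ℝ 2 lhat x‖ = ‖fderiv ℝ (fderiv ℝ lhat) x‖ := by
    rw [← norm_iteratedFDeriv_one, norm_iteratedFDeriv_fderiv]
  have hnorm : C * ∫ z : EuclideanSpace ℝ (Fin d), GSH.g b z = 1 := by
    have h := GaussianFourier.integral_rexp_neg_mul_sq_norm (V := EuclideanSpace ℝ (Fin d)) hb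
    simp only [GSH.g]
    rw [h, finrank_euclideanSpace_fin, hC, hbdef]
    have e : π / (1 / (2 * σ ^ 2)) = 2 * π * σ ^ 2 := by field_simp
    rw [e, ← Real.rpow_add (by positivity)]
    have e2 : -(d : ℝ) / 2 + d / 2 = 0 := by ring
    rw [e2, Real.rpow_zero]
  rw [hn, hd2.fderiv]
  refine (GSH.ns (G := GSH.EE d →L[ℝ] GSH.EE d →L[ℝ] ℝ) _ _).le.trans ?_
  rw [Real.norm_of_nonneg hC0]
  calc C * ‖∫ t, ℓ t • GSH.g2 b (x - t)‖
      ≤ C * (4 * b * M * ∫ z : EuclideanSpace ℝ (Fin d), GSH.g b z) := by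
        gcongr
        exact GSH.integral_bound hb ℓ hmeas hl x
    _ = 4 * b * M * (C * ∫ z : EuclideanSpace ℝ (Fin d), GSH.g b z) := by ring
    _ = 2 * M / σ ^ 2 := by
        rw [hnorm, hbdef]
        field_simp
        norm_num
end

section
/- If ℓ : ℝᵈ → ℝ is measurable with 0 ≤ ℓ(t) ≤ M, then the Gaussian-smoothed function ℓ̂(x) = E_{z∼N(0,σ²I)}[ℓ(x+z)] is (2M/σ²)-smooth, i.e., its gradient is (2M/σ²)-Lipschitz: ‖∇ℓ̂(x) - ∇ℓ̂(x')‖ ≤ (2M/σ²)‖x - x'‖ for all x, x'. -/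
open MeasureTheory Real

section GaussHelpers

variable {E : Type*} [NormedAddCommGroup E] [InnerProductSpace ℝ E] [FiniteDimensional ℝ E]
  [MeasurableSpace E] [BorelSpace E]

lemma gs_integrable_exp {b : ℝ} (hb : 0 < b) :
    Integrable (fun y : E => rexp (-b * ‖y‖ ^ 2)) := by
  by_contra h
  have h1 := integral_undef h
  rw [GaussianFourier.integral_rexp_neg_mul_sq_norm hb] at h1
  have : 0 < (π / b) ^ ((Module.finrank ℝ E : ℝ) / 2) := by positivity
  linarith

lemma gs_poly_bound {a : ℝ} (ha : 0 < a) (y : E) :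
    (1 + ‖y‖ ^ 2) * rexp (-a * ‖y‖ ^ 2) ≤ (1 + 2 / a) * rexp (-(a / 2) * ‖y‖ ^ 2) := by
  have h1 : 1 + ‖y‖ ^ 2 ≤ (1 + 2 / a) * rexp ((a / 2) * ‖y‖ ^ 2) := by
    have h2 := Real.add_one_le_exp ((a / 2) * ‖y‖ ^ 2)
    calc 1 + ‖y‖ ^ 2 ≤ (1 + 2 / a) * ((a / 2) * ‖y‖ ^ 2 + 1) := by
          have : (1 + 2 / a) * ((a / 2) * ‖y‖ ^ 2 + 1)
            = 1 + ‖y‖ ^ 2 + (a / 2 * ‖y‖ ^ 2 + 2 / a) := by field_simp; ring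
          rw [this]
          have : 0 ≤ a / 2 * ‖y‖ ^ 2 + 2 / a := by positivity
          linarith
      _ ≤ _ := by gcongr
  calc (1 + ‖y‖ ^ 2) * rexp (-a * ‖y‖ ^ 2)
      ≤ ((1 + 2 / a) * rexp ((a / 2) * ‖y‖ ^ 2)) * rexp (-a * ‖y‖ ^ 2) := by gcongr
    _ = _ := by rw [mul_assoc, ← Real.exp_add]; congr 2; ring

lemma gs_integrable_of_bound {F : Type*} [NormedAddCommGroup F] {a K : ℝ} (ha : 0 < a)
    {φ : E → F} (hφ : AEStronglyMeasurable φ volume) (hK : 0 ≤ K)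
    (hb : ∀ y, ‖φ y‖ ≤ K * ((1 + ‖y‖ ^ 2) * rexp (-a * ‖y‖ ^ 2))) :
    Integrable φ := by
  refine Integrable.mono' (((gs_integrable_exp (E := E) (half_pos ha)).const_mul
    (1 + 2 / a)).const_mul K) hφ ?_
  filter_upwards with y
  exact (hb y).trans (mul_le_mul_of_nonneg_left (gs_poly_bound ha y) hK)

lemma gs_hasFDerivAt {a K M : ℝ} (ha : 0 < a) (hK : 0 ≤ K)
    {ℓ : E → ℝ} (hmeas : Measurable ℓ) (hbound : ∀ t, |ℓ t| ≤ M)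
    {φ : E → ℝ} {φ' : E → E →L[ℝ] ℝ}
    (hd : ∀ y, HasFDerivAt φ (φ' y) y) (hc : Continuous φ')
    (hb : ∀ y, ‖φ y‖ ≤ K * ((1 + ‖y‖ ^ 2) * rexp (-a * ‖y‖ ^ 2)))
    (hb' : ∀ y, ‖φ' y‖ ≤ K * ((1 + ‖y‖ ^ 2) * rexp (-a * ‖y‖ ^ 2))) (x : E) :
    Integrable (fun t => ℓ t • φ' (x - t)) ∧
    HasFDerivAt (fun x => ∫ t, ℓ t * φ (x - t)) (∫ t, ℓ t • φ' (x - t)) x := by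
  have hM : 0 ≤ M := (abs_nonneg _).trans (hbound 0)
  have hφc : Continuous φ := continuous_iff_continuousAt.2 fun y => (hd y).continuousAt
  have hbl : ∀ᵐ t : E, ‖ℓ t‖ ≤ M := by filter_upwards with t using hbound t
  have hi' : Integrable (fun t => ℓ t • φ' (x - t)) :=
    ((gs_integrable_of_bound ha hc.aestronglyMeasurable hK hb').comp_sub_left x).bdd_smul M
      hmeas.aestronglyMeasurable hbl
  refine ⟨hi', ?_⟩
  have hcomp : Integrable (fun t : E =>
      M * (K * ((1 + 2 / a) * (rexp (a / 2) * rexp (-(a / 4) * ‖x - t‖ ^ 2))))) :=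
    (((((gs_integrable_exp (E := E) (b := a / 4) (by positivity)).comp_sub_left x).const_mul
      _).const_mul _).const_mul _).const_mul _
  refine hasFDerivAt_integral_of_dominated_of_fderiv_le (𝕜 := ℝ)
    (F' := fun x t => ℓ t • φ' (x - t)) (Metric.ball_mem_nhds x one_pos) ?_ ?_
    hi'.aestronglyMeasurable ?_ hcomp ?_
  · filter_upwards with z
    exact (hmeas.mul (hφc.measurable.comp (measurable_const.sub measurable_id))).aestronglyMeasurable
  · exact ((gs_integrable_of_bound ha hφc.aestronglyMeasurable hK hb).comp_sub_left x).bdd_mul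
      hmeas.aestronglyMeasurable hbl
  · filter_upwards with t z hz
    rw [norm_smul]
    have hz1 : ‖x - z‖ ≤ 1 := by
      rw [Metric.mem_ball, dist_eq_norm] at hz
      rw [norm_sub_rev]; exact hz.le
    have htri : ‖x - t‖ ≤ 1 + ‖z - t‖ := by
      calc ‖x - t‖ = ‖(x - z) + (z - t)‖ := by congr 1; abel
        _ ≤ ‖x - z‖ + ‖z - t‖ := norm_add_le _ _
        _ ≤ _ := by gcongr
    have hsq : ‖x - t‖ ^ 2 ≤ 2 + 2 * ‖z - t‖ ^ 2 := by
      nlinarith [norm_nonneg (x - t), norm_nonneg (z - t), sq_nonneg (‖z - t‖ - 1)]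
    have hexp : rexp (-(a / 2) * ‖z - t‖ ^ 2) ≤ rexp (a / 2) * rexp (-(a / 4) * ‖x - t‖ ^ 2) := by
      rw [← Real.exp_add, Real.exp_le_exp]
      nlinarith
    refine mul_le_mul (hbound t) ?_ (norm_nonneg _) hM
    refine (hb' _).trans (mul_le_mul_of_nonneg_left ?_ hK)
    refine (gs_poly_bound ha _).trans (mul_le_mul_of_nonneg_left hexp (by positivity))
  · filter_upwards with t z _
    have h := (hd (z - t)).comp z ((hasFDerivAt_id z).sub_const t)
    exact h.const_mul (ℓ t)

/-- first derivative of the Gaussian -/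
lemma gs_deriv1 (a : ℝ) (y : E) :
    HasFDerivAt (fun y : E => rexp (-a * ‖y‖ ^ 2))
      ((-(2 * a) * rexp (-a * ‖y‖ ^ 2)) • innerSL ℝ y) y := by
  have h := (((hasFDerivAt_id (𝕜 := ℝ) y).norm_sq).const_mul (-a)).exp
  refine h.congr_fderiv ?_
  ext v
  simp
  ring

/-- second derivative of the Gaussian -/
lemma gs_deriv2 (a : ℝ) (v y : E) :
    HasFDerivAt (fun y : E => -(2 * a) * rexp (-a * ‖y‖ ^ 2) * inner ℝ v y)
      (rexp (-a * ‖y‖ ^ 2) • ((4 * a ^ 2 * inner ℝ v y) • innerSL ℝ y - (2 * a) • innerSL ℝ v)) y := by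
  have h := ((gs_deriv1 a y).const_mul (-(2 * a))).mul ((innerSL ℝ v).hasFDerivAt (x := y))
  refine h.congr_fderiv ?_
  ext u
  simp
  ring

lemma gs_integrable_inner {a : ℝ} (ha : 0 < a) (u v : E) :
    Integrable (fun y : E => inner ℝ u y * inner ℝ v y * rexp (-a * ‖y‖ ^ 2)) := by
  refine gs_integrable_of_bound (K := ‖u‖ * ‖v‖) ha
    (Continuous.aestronglyMeasurable (by fun_prop)) (by positivity) fun y => ?_
  rw [norm_mul, norm_mul, Real.norm_of_nonneg (Real.exp_pos _).le, ← mul_assoc]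
  refine mul_le_mul_of_nonneg_right ?_ (Real.exp_pos _).le
  calc ‖(inner ℝ u y : ℝ)‖ * ‖(inner ℝ v y : ℝ)‖ ≤ (‖u‖ * ‖y‖) * (‖v‖ * ‖y‖) := by
        gcongr <;> exact norm_inner_le_norm _ _
    _ = ‖u‖ * ‖v‖ * ‖y‖ ^ 2 := by ring
    _ ≤ _ := by gcongr; linarith

lemma gs_moment {a : ℝ} (ha : 0 < a) (u : E) :
    ∫ y : E, inner ℝ u y * inner ℝ u y * rexp (-a * ‖y‖ ^ 2) =
      ‖u‖ ^ 2 / (2 * a) * ∫ y : E, rexp (-a * ‖y‖ ^ 2) := by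
  have key := integral_bilinear_hasFDerivAt_right_eq_neg_left_of_integrable
    (μ := (volume : Measure E)) (B := ContinuousLinearMap.mul ℝ ℝ) (v := u)
    (f := fun y : E => inner ℝ u y) (f' := fun _ => innerSL ℝ u)
    (g := fun y : E => rexp (-a * ‖y‖ ^ 2))
    (g' := fun y => (-(2 * a) * rexp (-a * ‖y‖ ^ 2)) • innerSL ℝ y)
    ?_ ?_ ?_ (fun x _ => (innerSL ℝ u).hasFDerivAt) (fun x _ => gs_deriv1 a x)
  · have e1 : ∀ y : E, (ContinuousLinearMap.mul ℝ ℝ) (inner ℝ u y)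
        (((-(2 * a) * rexp (-a * ‖y‖ ^ 2)) • innerSL ℝ y) u) =
        -(2 * a) * (inner ℝ u y * inner ℝ u y * rexp (-a * ‖y‖ ^ 2)) := by
      intro y; simp [real_inner_comm u y]; ring
    have e2 : ∀ y : E, (ContinuousLinearMap.mul ℝ ℝ) (innerSL ℝ u u) (rexp (-a * ‖y‖ ^ 2)) =
        ‖u‖ ^ 2 * rexp (-a * ‖y‖ ^ 2) := by
      intro y; simp
    simp_rw [e1, e2] at key
    rw [integral_const_mul, integral_const_mul] at key
    rw [div_mul_eq_mul_div, eq_div_iff (by positivity)]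
    linarith
  · simpa using (gs_integrable_exp (E := E) ha).const_mul (‖u‖ ^ 2)
  · refine ((gs_integrable_inner ha u u).const_mul (-(2 * a))).congr ?_
    filter_upwards with y
    simp [real_inner_comm u y]; ring
  · refine gs_integrable_of_bound (K := ‖u‖) ha
      (Continuous.aestronglyMeasurable (by simp; fun_prop)) (by positivity) fun y => ?_
    rw [ContinuousLinearMap.mul_apply', norm_mul, Real.norm_of_nonneg (Real.exp_pos _).le,
      ← mul_assoc]
    gcongr
    refine (norm_inner_le_norm _ _).trans ?_
    gcongr
    nlinarith [sq_nonneg (‖y‖ - 1)]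

lemma gs_moment_abs {a : ℝ} (ha : 0 < a) (u v : E) :
    ∫ y : E, |inner ℝ u y * inner ℝ v y| * rexp (-a * ‖y‖ ^ 2) ≤
      ‖u‖ * ‖v‖ / (2 * a) * ∫ y : E, rexp (-a * ‖y‖ ^ 2) := by
  rcases eq_or_ne u 0 with rfl | hu
  · simp
  rcases eq_or_ne v 0 with rfl | hv
  · simp
  have hu' : 0 < ‖u‖ := norm_pos_iff.2 hu
  have hv' : 0 < ‖v‖ := norm_pos_iff.2 hv
  have h : ∫ y : E, |inner ℝ u y * inner ℝ v y| * rexp (-a * ‖y‖ ^ 2) ≤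
      ∫ y : E, ((‖v‖ / (2 * ‖u‖)) * (inner ℝ u y * inner ℝ u y * rexp (-a * ‖y‖ ^ 2)) +
        (‖u‖ / (2 * ‖v‖)) * (inner ℝ v y * inner ℝ v y * rexp (-a * ‖y‖ ^ 2))) := by
    refine integral_mono_of_nonneg ?_ ?_ ?_
    · filter_upwards with y; positivity
    · exact ((gs_integrable_inner ha u u).const_mul _).add ((gs_integrable_inner ha v v).const_mul _)
    · filter_upwards with y
      have : |(inner ℝ u y : ℝ) * inner ℝ v y| ≤ (‖v‖ / (2 * ‖u‖)) * (inner ℝ u y * inner ℝ u y)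
          + (‖u‖ / (2 * ‖v‖)) * (inner ℝ v y * inner ℝ v y) := by
        generalize (inner ℝ u y : ℝ) = p
        generalize (inner ℝ v y : ℝ) = q
        have e : (‖v‖ / (2 * ‖u‖)) * (p * p) + (‖u‖ / (2 * ‖v‖)) * (q * q) =
          ((‖v‖ * p) ^ 2 + (‖u‖ * q) ^ 2) / (2 * ‖u‖ * ‖v‖) := by field_simp
        rw [e, le_div_iff₀ (by positivity), abs_mul]
        have := sq_nonneg (‖v‖ * |p| - ‖u‖ * |q|)
        have e2 : (‖v‖ * |p| - ‖u‖ * |q|) ^ 2 =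
            (‖v‖ * p) ^ 2 + (‖u‖ * q) ^ 2 - |p| * |q| * (2 * ‖u‖ * ‖v‖) := by
          rw [mul_pow ‖v‖ p, mul_pow ‖u‖ q, ← sq_abs p, ← sq_abs q]; ring
        linarith
      calc _ ≤ _ := mul_le_mul_of_nonneg_right this (Real.exp_pos _).le
        _ = _ := by ring
  rw [integral_add ((gs_integrable_inner ha u u).const_mul _)
    ((gs_integrable_inner ha v v).const_mul _), integral_const_mul, integral_const_mul,
    gs_moment ha, gs_moment ha] at h
  refine h.trans (le_of_eq ?_)
  field_simp
  ring

lemma gs_main {a M : ℝ} (ha : 0 < a)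
    {ℓ : E → ℝ} (hmeas : Measurable ℓ) (hbound : ∀ t, |ℓ t| ≤ M) :
    Differentiable ℝ (fun x => ∫ t, ℓ t * rexp (-a * ‖x - t‖ ^ 2)) ∧
    ∀ x x', ‖fderiv ℝ (fun x => ∫ t, ℓ t * rexp (-a * ‖x - t‖ ^ 2)) x -
      fderiv ℝ (fun x => ∫ t, ℓ t * rexp (-a * ‖x - t‖ ^ 2)) x'‖ ≤
      4 * a * M * (∫ y : E, rexp (-a * ‖y‖ ^ 2)) * ‖x - x'‖ := by
  have hM : 0 ≤ M := (abs_nonneg _).trans (hbound 0)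
  have hZ : 0 ≤ ∫ y : E, rexp (-a * ‖y‖ ^ 2) := integral_nonneg fun y => (Real.exp_pos _).le
  have h1 := fun x => gs_hasFDerivAt (K := 1 + 2 * a) ha (by positivity) hmeas hbound
    (fun y => gs_deriv1 a y) (by fun_prop) (fun y => by
      rw [Real.norm_of_nonneg (Real.exp_pos _).le, ← mul_assoc]
      refine le_mul_of_one_le_left (Real.exp_pos _).le ?_
      nlinarith [sq_nonneg ‖y‖, mul_nonneg ha.le (sq_nonneg ‖y‖)]) (fun y => by
      rw [norm_smul, norm_mul, Real.norm_of_nonneg (Real.exp_pos _).le, innerSL_apply_norm,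
        norm_neg, Real.norm_of_nonneg (by positivity : 0 ≤ 2 * a)]
      have : 2 * a * ‖y‖ ≤ (1 + 2 * a) * (1 + ‖y‖ ^ 2) := by
        nlinarith [sq_nonneg (‖y‖ - 1), mul_nonneg ha.le (sq_nonneg (‖y‖ - 1)),
          mul_nonneg ha.le (sq_nonneg ‖y‖)]
      nlinarith [Real.exp_pos (-a * ‖y‖ ^ 2)]) x
  have h2 := fun v x => gs_hasFDerivAt (K := ‖v‖ * (4 * a ^ 2 + 2 * a)) ha (by positivity)
    hmeas hbound
    (fun y => gs_deriv2 a v y) (by fun_prop) (fun y => by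
      rw [norm_mul, norm_mul, Real.norm_of_nonneg (Real.exp_pos _).le,
        norm_neg, Real.norm_of_nonneg (by positivity : 0 ≤ 2 * a)]
      calc 2 * a * rexp (-a * ‖y‖ ^ 2) * ‖(inner ℝ v y : ℝ)‖
          ≤ 2 * a * rexp (-a * ‖y‖ ^ 2) * (‖v‖ * ‖y‖) := by
            gcongr; exact norm_inner_le_norm _ _
        _ = ‖v‖ * (2 * a) * (‖y‖ * rexp (-a * ‖y‖ ^ 2)) := by ring
        _ ≤ _ := by
          gcongr
          · nlinarith [sq_nonneg a]
          · nlinarith [sq_nonneg (‖y‖ - 1)]) (fun y => by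
      rw [norm_smul, Real.norm_of_nonneg (Real.exp_pos _).le]
      have : ‖(4 * a ^ 2 * inner ℝ v y) • innerSL ℝ y - (2 * a) • innerSL ℝ v‖ ≤
          ‖v‖ * (4 * a ^ 2 + 2 * a) * (1 + ‖y‖ ^ 2) := by
        refine (norm_sub_le _ _).trans ?_
        rw [norm_smul, norm_smul, innerSL_apply_norm, innerSL_apply_norm, norm_mul,
          Real.norm_of_nonneg (by positivity : 0 ≤ 2 * a),
          Real.norm_of_nonneg (by positivity : 0 ≤ 4 * a ^ 2)]
        calc _ ≤ 4 * a ^ 2 * (‖v‖ * ‖y‖) * ‖y‖ + 2 * a * ‖v‖ := by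
              gcongr; exact norm_inner_le_norm _ _
          _ ≤ 4 * a ^ 2 * (‖v‖ * ‖y‖) * ‖y‖ + 2 * a * ‖v‖ +
              (‖v‖ * (4 * a ^ 2) + ‖v‖ * (2 * a) * ‖y‖ ^ 2) :=
              le_add_of_nonneg_right (by positivity)
          _ = _ := by ring
      calc _ ≤ rexp (-a * ‖y‖ ^ 2) * (‖v‖ * (4 * a ^ 2 + 2 * a) * (1 + ‖y‖ ^ 2)) := by gcongr
        _ = _ := by ring) x
  refine ⟨fun x => (h1 x).2.differentiableAt, fun x x' => ?_⟩
  refine ContinuousLinearMap.opNorm_le_bound _ (by positivity) fun v => ?_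
  have hv : ∀ x, fderiv ℝ (fun x => ∫ t, ℓ t * rexp (-a * ‖x - t‖ ^ 2)) x v =
      ∫ t, ℓ t * (-(2 * a) * rexp (-a * ‖x - t‖ ^ 2) * inner ℝ v (x - t)) := by
    intro x
    rw [(h1 x).2.fderiv, ContinuousLinearMap.integral_apply (h1 x).1]
    congr 1
    ext t
    simp only [ContinuousLinearMap.smul_apply, innerSL_apply_apply, smul_eq_mul]
    rw [real_inner_comm]
  rw [ContinuousLinearMap.sub_apply, hv, hv]
  have hmv := Convex.norm_image_sub_le_of_norm_hasFDerivWithin_le (s := Set.univ)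
    (C := 4 * a * M * (∫ y : E, rexp (-a * ‖y‖ ^ 2)) * ‖v‖) (x := x') (y := x)
    (fun z _ => (h2 v z).2.hasFDerivWithinAt) ?_ convex_univ (Set.mem_univ _) (Set.mem_univ _)
  · refine hmv.trans (le_of_eq ?_)
    ring
  · intro z _
    refine ContinuousLinearMap.opNorm_le_bound _ (by positivity) fun u => ?_
    rw [ContinuousLinearMap.integral_apply (h2 v z).1]
    let ψ : E → ℝ := fun y => 4 * a ^ 2 * (|inner ℝ v y * inner ℝ u y| * rexp (-a * ‖y‖ ^ 2)) +
      2 * a * (‖v‖ * ‖u‖) * rexp (-a * ‖y‖ ^ 2)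
    have hi1 : Integrable (fun y : E => |inner ℝ v y * inner ℝ u y| * rexp (-a * ‖y‖ ^ 2)) := by
      refine (gs_integrable_inner ha v u).norm.congr ?_
      filter_upwards with y
      rw [norm_mul, Real.norm_of_nonneg (Real.exp_pos _).le, Real.norm_eq_abs]
    have hi2 := gs_integrable_exp (E := E) ha
    have hψ : Integrable ψ := (hi1.const_mul _).add (hi2.const_mul _)
    have hle : ‖∫ t, (ℓ t • (rexp (-a * ‖z - t‖ ^ 2) • ((4 * a ^ 2 * inner ℝ v (z - t)) •
        innerSL ℝ (z - t) - (2 * a) • innerSL ℝ v))) u‖ ≤ ∫ t, M * ψ (z - t) := by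
      refine norm_integral_le_of_norm_le ((hψ.comp_sub_left z).const_mul M) ?_
      filter_upwards with t
      generalize z - t = y
      simp only [ContinuousLinearMap.smul_apply, ContinuousLinearMap.sub_apply,
        innerSL_apply_apply, smul_eq_mul]
      rw [norm_mul, norm_mul, Real.norm_of_nonneg (Real.exp_pos _).le]
      refine mul_le_mul (hbound t) ?_ (by positivity) hM
      have : ‖4 * a ^ 2 * inner ℝ v y * inner ℝ y u - 2 * a * inner ℝ v u‖ ≤
          4 * a ^ 2 * |inner ℝ v y * inner ℝ u y| + 2 * a * (‖v‖ * ‖u‖) := by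
        refine (norm_sub_le _ _).trans ?_
        rw [real_inner_comm u y, mul_assoc, norm_mul, norm_mul (2 * a),
          Real.norm_of_nonneg (by positivity : 0 ≤ 2 * a),
          Real.norm_of_nonneg (by positivity : 0 ≤ 4 * a ^ 2)]
        gcongr
        · exact le_rfl
        · exact norm_inner_le_norm _ _
      calc _ ≤ rexp (-a * ‖y‖ ^ 2) * _ := mul_le_mul_of_nonneg_left this (Real.exp_pos _).le
        _ = ψ y := by simp only [ψ]; ring
    refine hle.trans ?_
    rw [integral_const_mul, integral_sub_left_eq_self ψ volume z,
      integral_add (hi1.const_mul _) (hi2.const_mul _), integral_const_mul, integral_const_mul]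
    calc _ ≤ M * (4 * a ^ 2 * (‖v‖ * ‖u‖ / (2 * a) * ∫ y : E, rexp (-a * ‖y‖ ^ 2)) +
          2 * a * (‖v‖ * ‖u‖) * ∫ y : E, rexp (-a * ‖y‖ ^ 2)) := by
          gcongr; exact gs_moment_abs ha v u
      _ = _ := by field_simp; ring

end GaussHelpers

/-- the Gaussian smoothing of a measurable loss bounded in `[0, M]`
is `(2M/σ²)`-smooth, i.e. differentiable with `(2M/σ²)`-Lipschitz gradient. -/
theorem gaussian_smoothing_is_smooth
    {d : ℕ} (σ M : ℝ) (hσ : 0 < σ)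
    (ℓ : EuclideanSpace ℝ (Fin d) → ℝ) (hmeas : Measurable ℓ)
    (hbound : ∀ t, 0 ≤ ℓ t ∧ ℓ t ≤ M)
    (lhat : EuclideanSpace ℝ (Fin d) → ℝ)
    (hlhat : ∀ x, lhat x =
      (2 * π * σ ^ 2) ^ (-(d : ℝ) / 2) *
        ∫ t, ℓ t * Real.exp (-‖x - t‖ ^ 2 / (2 * σ ^ 2))) :
    Differentiable ℝ lhat ∧
      ∀ x x', ‖fderiv ℝ lhat x - fderiv ℝ lhat x'‖ ≤ 2 * M / σ ^ 2 * ‖x - x'‖ := by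
  have ha : 0 < 1 / (2 * σ ^ 2) := by positivity
  obtain ⟨hd, hL⟩ := gs_main (M := M) ha hmeas
    (fun t => by rw [abs_of_nonneg (hbound t).1]; exact (hbound t).2)
  have hc : 0 ≤ (2 * π * σ ^ 2) ^ (-(d : ℝ) / 2) := by positivity
  have hZ : (2 * π * σ ^ 2) ^ (-(d : ℝ) / 2) *
      ∫ y : EuclideanSpace ℝ (Fin d), rexp (-(1 / (2 * σ ^ 2)) * ‖y‖ ^ 2) = 1 := by
    rw [GaussianFourier.integral_rexp_neg_mul_sq_norm ha, finrank_euclideanSpace_fin]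
    have : π / (1 / (2 * σ ^ 2)) = 2 * π * σ ^ 2 := by field_simp
    rw [this, ← Real.rpow_add (by positivity)]
    have : -(d : ℝ) / 2 + d / 2 = 0 := by ring
    rw [this, Real.rpow_zero]
  generalize (2 * π * σ ^ 2) ^ (-(d : ℝ) / 2) = c at *
  have he : lhat = fun x => c * ∫ t, ℓ t * rexp (-(1 / (2 * σ ^ 2)) * ‖x - t‖ ^ 2) := by
    ext x
    rw [hlhat]
    congr 2
    ext t
    congr 2
    ring
  subst he
  refine ⟨hd.const_mul c, fun x x' => ?_⟩
  rw [fderiv_const_mul (hd x), fderiv_const_mul (hd x'), ← smul_sub, norm_smul,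
    Real.norm_of_nonneg hc]
  calc _ ≤ c * _ := mul_le_mul_of_nonneg_left (hL x x') hc
    _ = (4 * (1 / (2 * σ ^ 2)) * M) * (c * ∫ y : EuclideanSpace ℝ (Fin d),
        rexp (-(1 / (2 * σ ^ 2)) * ‖y‖ ^ 2)) * ‖x - x'‖ := by ring
    _ = _ := by rw [hZ]; field_simp; ring
end

section
/- Smooth descent lemma with biased gradients: if F is L-smooth and θ^{t+1} = θ^t - η g^t with η ≤ 1/L, then F(θ^{t+1}) ≤ F(θ^t) - (η/2)‖∇F(θ^t)‖² + (η(1+Lη)/2)‖δ^t‖² + Lη²‖∇F(θ^t) - h^t‖² + η(1-Lη)⟨∇F(θ^t), ∇F(θ^t) - h^t⟩, where g^t = h^t - δ^t decomposes the update into an unbiased part h^t and bias δ^t. -/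
open RealInnerProductSpace

theorem smooth_upper_bound {p : ℕ} (F : EuclideanSpace ℝ (Fin p) → ℝ) (L : ℝ)
    (hdiff : Differentiable ℝ F)
    (hsmooth : ∀ θ θ', ‖gradient F θ - gradient F θ'‖ ≤ L * ‖θ - θ'‖)
    (x v : EuclideanSpace ℝ (Fin p)) :
    F (x + v) ≤ F x + ⟪gradient F x, v⟫ + L / 2 * ‖v‖ ^ 2 := by
  have hd : ∀ t : ℝ, HasDerivAt
      (fun t : ℝ => F (x + t • v) - t * ⟪gradient F x, v⟫ - L / 2 * ‖v‖ ^ 2 * t ^ 2)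
      (⟪gradient F (x + t • v), v⟫ - ⟪gradient F x, v⟫ - L * ‖v‖ ^ 2 * t) t := by
    intro t
    have h1 : HasDerivAt (fun t : ℝ => x + t • v) v t := by
      simpa using ((hasDerivAt_id t).smul_const v).const_add x
    have h2 := (hdiff (x + t • v)).hasGradientAt.hasFDerivAt.comp_hasDerivAt t h1
    have h3 := (h2.sub ((hasDerivAt_id t).mul_const ⟪gradient F x, v⟫)).sub
      (((hasDerivAt_id t).pow 2).const_mul (L / 2 * ‖v‖ ^ 2))
    refine h3.congr_deriv ?_
    simp
    ring
  have hanti := antitoneOn_of_deriv_nonpos (convex_Icc (0 : ℝ) 1)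
    (fun t _ => (hd t).continuousAt.continuousWithinAt)
    (fun t _ => (hd t).differentiableAt.differentiableWithinAt)
    (by
      intro t ht
      rw [interior_Icc] at ht
      rw [(hd t).deriv, ← inner_sub_left]
      have h1 := real_inner_le_norm (gradient F (x + t • v) - gradient F x) v
      have h2 := hsmooth (x + t • v) x
      rw [add_sub_cancel_left, norm_smul, Real.norm_of_nonneg ht.1.le] at h2
      have h3 := mul_le_mul_of_nonneg_right h2 (norm_nonneg v)
      nlinarith)
  have h := hanti (Set.left_mem_Icc.2 zero_le_one) (Set.right_mem_Icc.2 zero_le_one) zero_le_one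
  simp only [one_smul, zero_smul, add_zero] at h
  linarith

/-- descent lemma for one gradient step with a biased gradient
estimate `g = h - δ` (`h` the unbiased part, `δ` the bias): if `F` is
`L`-smooth and `θ⁺ = θ - η g` with `η ≤ 1/L`, then
`F(θ⁺) ≤ F(θ) - (η/2)‖∇F(θ)‖² + (η(1+Lη)/2)‖δ‖² + Lη²‖∇F(θ) - h‖²
  + η(1-Lη)⟨∇F(θ), ∇F(θ) - h⟩`. -/
theorem biased_descent_lemma
    {p : ℕ} (F : EuclideanSpace ℝ (Fin p) → ℝ) (L η : ℝ)
    (hL : 0 < L)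
    (hdiff : Differentiable ℝ F)
    (hsmooth : ∀ θ θ', ‖gradient F θ - gradient F θ'‖ ≤ L * ‖θ - θ'‖)
    (hη : 0 < η) (hηL : η ≤ 1 / L)
    (θt θt1 gt ht δt : EuclideanSpace ℝ (Fin p))
    (hg : gt = ht - δt)
    (hstep : θt1 = θt - η • gt) :
    F θt1 ≤ F θt - η / 2 * ‖gradient F θt‖ ^ 2
      + η * (1 + L * η) / 2 * ‖δt‖ ^ 2
      + L * η ^ 2 * ‖gradient F θt - ht‖ ^ 2
      + η * (1 - L * η) * ⟪gradient F θt, gradient F θt - ht⟫ := by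
  have hLη : L * η ≤ 1 := by
    rw [le_div_iff₀ hL] at hηL
    linarith
  have key := smooth_upper_bound F L hdiff hsmooth θt (-(η • gt))
  rw [← sub_eq_add_neg, ← hstep] at key
  generalize gradient F θt = G at *
  obtain ⟨u, rfl⟩ : ∃ u, ht = G - u := ⟨G - ht, by abel⟩
  have e : gt = G - (u + δt) := by rw [hg]; abel
  rw [norm_neg, norm_smul, mul_pow, Real.norm_eq_abs, sq_abs, inner_neg_right,
    real_inner_smul_right, e, norm_sub_sq_real, inner_sub_right, inner_add_right,
    real_inner_self_eq_norm_sq, norm_add_sq_real] at key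
  rw [sub_sub_cancel]
  have h1 := norm_sub_sq_real G δt
  have h2 := norm_sub_sq_real u δt
  have h3 : 0 ≤ η * (1 - L * η) * ‖G - δt‖ ^ 2 :=
    mul_nonneg (mul_nonneg hη.le (by linarith)) (sq_nonneg _)
  have h4 : 0 ≤ L * η ^ 2 * ‖u - δt‖ ^ 2 := by positivity
  rw [h1] at h3
  rw [h2] at h4
  linarith
end
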